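/- arXiv:1911.03428 — 4 statements merged into one kernel-verified Lean document; each statement's English description precedes it below -/
import Mathlib

section
/- Let N' = {E(x10,x11,x21,x31,x32) : x10, x11, x21, x31, x32 ∈ k, x10 ≠ 0} and let D = {E(x10, 0, x21, x31, x32) : x10 ≠ 0}. Then the map from k × D to N' sending (x, n) to u(x)·n·u(x)⁻¹ is a bijection; equivalently, every element of N' is conjugate by a unique u(x) to a unique element of D. (Lemma 1.5.1.) -/
open Matrix

/-- The general element of the split Lie algebra of type `G₂`, realized as a `7 × 7` matrix. -/
def Xmat {k : Type*} [Field k]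
    (a b x01 x10 x11 x21 x31 x32 y01 y10 y11 y21 y31 y32 : k) :
    Matrix (Fin 7) (Fin 7) k :=
  !![a, x01, x32, 0, -x21, y10, 2*x11;
     y01, b, x31, x21, 0, -y11, 2*x10;
     y32, y31, -a-b, -y10, y11, 0, 2*y21;
     0, y21, -x10, -a, -y01, -y32, 2*y11;
     -y21, 0, x11, -x01, -b, -y31, 2*y10;
     x10, -x11, 0, -x32, -x31, a+b, 2*x21;
     y11, y10, x21, x11, x10, y21, 0]

/-- The exponential of a `7 × 7` matrix as a finite sum; for a nilpotent matrix (such as any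
nilpotent element of `G₂ ⊂ gl₇`) this is the genuine exponential, since `A ^ 7 = 0`. -/
noncomputable def mexp {k : Type*} [Field k] (A : Matrix (Fin 7) (Fin 7) k) :
    Matrix (Fin 7) (Fin 7) k :=
  ∑ i ∈ Finset.range 7, (Nat.factorial i : k)⁻¹ • A ^ i

/-- `E(x10, x11, x21, x31, x32)`: the exponential of the nilpotent element of `G₂` with upper
coordinates `x10, x11, x21, x31, x32` (and `x01 = 0`). -/
noncomputable def Emat {k : Type*} [Field k] (x10 x11 x21 x31 x32 : k) :
    Matrix (Fin 7) (Fin 7) k :=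
  mexp (Xmat 0 0 0 x10 x11 x21 x31 x32 0 0 0 0 0 0)

/-- `Ē(y10, y11, y21, y31, y32)`: the exponential of the nilpotent element of `G₂` with lower
coordinates `y10, y11, y21, y31, y32` (and `y01 = 0`). -/
noncomputable def Ebar {k : Type*} [Field k] (y10 y11 y21 y31 y32 : k) :
    Matrix (Fin 7) (Fin 7) k :=
  mexp (Xmat 0 0 0 0 0 0 0 0 0 y10 y11 y21 y31 y32)

/-- `u(x)`: the exponential of the nilpotent element of `G₂` with `x01 = x`, i.e. the simple
root vector in the Levi subgroup `GL₂ = M ⊂ G₂`. -/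
noncomputable def umat {k : Type*} [Field k] (x : k) : Matrix (Fin 7) (Fin 7) k :=
  mexp (Xmat 0 0 x 0 0 0 0 0 0 0 0 0 0 0)

/-- `z(t) = diag(t, t, t⁻², t⁻¹, t⁻¹, t², 1)`: the image of the central element `t·I₂` of the
Levi subgroup `GL₂ = M ⊂ G₂`. -/
noncomputable def zmat {k : Type*} [Field k] (t : k) : Matrix (Fin 7) (Fin 7) k :=
  Matrix.diagonal ![t, t, (t^2)⁻¹, t⁻¹, t⁻¹, t^2, 1]

theorem mexp_conj {k : Type*} [Field k] {U V : Matrix (Fin 7) (Fin 7) k} (h : V * U = 1)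
    (A : Matrix (Fin 7) (Fin 7) k) : U * mexp A * V = mexp (U * A * V) := by
  have h' : U * V = 1 := mul_eq_one_comm.mp h
  have hpow (i : ℕ) : (U * A * V) ^ i = U * A ^ i * V := by
    induction i with
    | zero => simp [h']
    | succ n ih =>
      calc (U * A * V) ^ (n + 1) = U * A ^ n * (V * U) * A * V := by
            rw [pow_succ, ih]; simp only [mul_assoc]
        _ = U * A ^ (n + 1) * V := by rw [h, mul_one, pow_succ, mul_assoc U]
  simp only [mexp, hpow, Finset.mul_sum, Finset.sum_mul, Matrix.mul_smul, Matrix.smul_mul]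

theorem umat_eq {k : Type*} [Field k] (x : k) :
    umat x = 1 + Xmat 0 0 x 0 0 0 0 0 0 0 0 0 0 0 := by
  have hsq : Xmat 0 0 x 0 0 0 0 0 0 0 0 0 0 0 ^ 2 = 0 := by
    ext i j
    fin_cases i <;> fin_cases j <;> simp [Xmat, pow_two, Matrix.mul_apply, Fin.sum_univ_succ]
  have hpow (n : ℕ) : Xmat 0 0 x 0 0 0 0 0 0 0 0 0 0 0 ^ (n + 2) = 0 := by
    rw [pow_add, hsq, mul_zero]
  simp [umat, mexp, Finset.sum_range_succ, hpow 0, hpow 1, hpow 2, hpow 3, hpow 4]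

theorem umat_neg_mul_umat {k : Type*} [Field k] (x : k) : umat (-x) * umat x = 1 := by
  rw [umat_eq, umat_eq]
  ext i j
  fin_cases i <;> fin_cases j <;>
    simp [Xmat, Matrix.mul_apply, Fin.sum_univ_succ, Matrix.one_apply]

theorem inv_umat {k : Type*} [Field k] (x : k) : (umat x)⁻¹ = umat (-x) :=
  Matrix.inv_eq_left_inv (umat_neg_mul_umat x)

theorem umat_conj_Emat {k : Type*} [Field k] (x x10 x11 x21 x31 x32 : k) :
    umat x * Emat x10 x11 x21 x31 x32 * (umat x)⁻¹ =
      Emat x10 (x11 + x * x10) x21 x31 (x32 + x * x31) := by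
  rw [inv_umat, Emat, mexp_conj (umat_neg_mul_umat x), Emat, umat_eq, umat_eq]
  congr 1
  ext i j
  fin_cases i <;> fin_cases j <;>
    simp [Xmat, Matrix.mul_apply, Fin.sum_univ_succ, Matrix.one_apply] <;> ring

theorem Emat_apply_five {k : Type*} [Field k] (x10 x11 x21 x31 x32 : k) :
    Emat x10 x11 x21 x31 x32 5 0 = x10 ∧ Emat x10 x11 x21 x31 x32 5 1 = -x11 := by
  set N := Xmat 0 0 0 x10 x11 x21 x31 x32 0 0 0 0 0 0 with hN
  have h5 (n : ℕ) : (N ^ (n + 1)) 5 5 = 0 := by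
    simp [pow_succ, Matrix.mul_apply, Fin.sum_univ_succ, hN, Xmat]
  have h0 (n : ℕ) : (N ^ (n + 2)) 5 0 = 0 := by
    rw [pow_succ, Matrix.mul_apply, Fin.sum_univ_seven, h5]
    simp [hN, Xmat]
  have h1 (n : ℕ) : (N ^ (n + 2)) 5 1 = 0 := by
    rw [pow_succ, Matrix.mul_apply, Fin.sum_univ_seven, h5]
    simp [hN, Xmat]
  have e0 : N 5 0 = x10 := by simp [hN, Xmat]
  have e1 : N 5 1 = -x11 := by simp [hN, Xmat]
  constructor
  · simp [Emat, mexp, ← hN, Finset.sum_range_succ, h0 0, h0 1, h0 2, h0 3, h0 4, e0]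
  · simp [Emat, mexp, ← hN, Finset.sum_range_succ, h1 0, h1 1, h1 2, h1 3, h1 4, e1]

/-- Lemma 1.5.1: with `N' = {E(x10,x11,x21,x31,x32) : x10 ≠ 0}` and
`D = {E(x10,0,x21,x31,x32) : x10 ≠ 0}`, the map `k × D → N'`, `(x, n) ↦ u(x)·n·u(x)⁻¹`,
is a bijection: it takes values in `N'`, and every element of `N'` is conjugate by a
unique `u(x)` to a unique element of `D`. -/
theorem orbit_space_D_bijection (k : Type*) [Field k] [CharZero k] :
    letI N' : Set (Matrix (Fin 7) (Fin 7) k) :=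
      {n | ∃ x10 x11 x21 x31 x32 : k, x10 ≠ 0 ∧ n = Emat x10 x11 x21 x31 x32}
    letI D : Set (Matrix (Fin 7) (Fin 7) k) :=
      {n | ∃ x10 x21 x31 x32 : k, x10 ≠ 0 ∧ n = Emat x10 0 x21 x31 x32}
    (∀ x : k, ∀ n ∈ D, umat x * n * (umat x)⁻¹ ∈ N') ∧
    (∀ n' ∈ N', ∃! q : k × Matrix (Fin 7) (Fin 7) k,
      q.2 ∈ D ∧ umat q.1 * q.2 * (umat q.1)⁻¹ = n') := by
  refine ⟨?_, ?_⟩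
  · rintro x _ ⟨p, r, s, t, hp, rfl⟩
    exact ⟨p, 0 + x * p, r, s, t + x * s, hp, umat_conj_Emat ..⟩
  · rintro _ ⟨p, q, r, s, t, hp, rfl⟩
    refine ⟨(q / p, Emat p 0 r s (t - q / p * s)), ⟨⟨p, r, s, _, hp, rfl⟩, ?_⟩, ?_⟩
    · rw [umat_conj_Emat]
      congr 1 <;> field_simp <;> ring
    · rintro ⟨x, _⟩ ⟨⟨p', r', s', t', -, rfl⟩, h⟩
      dsimp only at h
      have hconj := h
      rw [umat_conj_Emat] at h
      have h0 := congrFun (congrFun h 5) 0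
      have h1 := congrFun (congrFun h 5) 1
      rw [(Emat_apply_five ..).1, (Emat_apply_five ..).1] at h0
      rw [(Emat_apply_five ..).2, (Emat_apply_five ..).2, neg_inj, zero_add] at h1
      subst h0
      have hx : x = q / p' := eq_div_of_mul_eq hp h1
      have hU := umat_neg_mul_umat x
      refine Prod.ext hx ?_
      calc Emat p' 0 r' s' t'
          = umat (-x) * umat x * Emat p' 0 r' s' t' * (umat (-x) * umat x) := by simp [hU]
        _ = umat (-x) * (umat x * Emat p' 0 r' s' t' * (umat x)⁻¹) * (umat (-x))⁻¹ := by
            rw [inv_umat, inv_umat, neg_neg]; simp only [mul_assoc]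
        _ = Emat p' 0 r s (t - q / p' * s) := by
            rw [hconj, umat_conj_Emat, ← hx, ← h1]
            congr 1 <;> ring
end

section
/- Let N' = {E(x10,x11,x21,x31,x32) : x10 ≠ 0} and D₀ = {E(1, 0, x21, x31, x32) : x21, x31, x32 ∈ k}. Then the map from k × k^× × D₀ to N' sending (x, t, n₀) to u(x)·z(t)·n₀·z(t)⁻¹·u(x)⁻¹ is a bijection. Explicitly, in exponential coordinates this map is (x, t, x21, x31, x32) ↦ (t, x·t, t²·x21, t³·x31, x·t³·x31 + t³·x32), which is a bijection of k × k^× × k³ onto {(x10,x11,x21,x31,x32) ∈ k⁵ : x10 ≠ 0}. (Lemma 1.5.3(i).) -/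
open Matrix

theorem mexp_semiconjBy {k : Type*} [Field k] {P A B : Matrix (Fin 7) (Fin 7) k}
    (h : SemiconjBy P A B) : SemiconjBy P (mexp A) (mexp B) := by
  simp only [SemiconjBy, mexp, Finset.mul_sum, Finset.sum_mul, Matrix.mul_smul, Matrix.smul_mul]
  exact Finset.sum_congr rfl fun i _ => by rw [(h.pow_right i).eq]

theorem isUnit_det_umat {k : Type*} [Field k] (x : k) : IsUnit (umat x).det := by
  refine Matrix.isUnit_det_of_right_inverse (B := umat (-x)) ?_
  rw [umat_eq, umat_eq]
  ext i j
  fin_cases i <;> fin_cases j <;>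
    simp [Xmat, Matrix.mul_apply, Fin.sum_univ_succ, Matrix.one_apply]

theorem isUnit_det_zmat {k : Type*} [Field k] {t : k} (ht : t ≠ 0) : IsUnit (zmat t).det := by
  simp [zmat, Fin.prod_univ_succ, ht]

theorem semiconjBy_zmat {k : Type*} [Field k] {t : k} (ht : t ≠ 0) (x10 x11 x21 x31 x32 : k) :
    SemiconjBy (zmat t) (Emat x10 x11 x21 x31 x32)
      (Emat (t * x10) (t * x11) (t ^ 2 * x21) (t ^ 3 * x31) (t ^ 3 * x32)) := by
  apply mexp_semiconjBy
  rw [SemiconjBy, zmat]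
  ext i j
  rw [Matrix.diagonal_mul, Matrix.mul_diagonal]
  fin_cases i <;> fin_cases j <;> simp [Xmat] <;> field_simp

set_option maxHeartbeats 1000000 in
theorem semiconjBy_umat {k : Type*} [Field k] (x x10 x11 x21 x31 x32 : k) :
    SemiconjBy (umat x) (Emat x10 x11 x21 x31 x32)
      (Emat x10 (x11 + x * x10) x21 x31 (x32 + x * x31)) := by
  apply mexp_semiconjBy
  rw [SemiconjBy, umat_eq, add_mul, mul_add, one_mul, mul_one]
  ext i j
  fin_cases i <;> fin_cases j <;>
    simp [Xmat] <;> ring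

/-- The action of `u(x) z(t)` by conjugation, in exponential coordinates. -/
theorem umat_zmat_conj_Emat {k : Type*} [Field k] {t : k} (ht : t ≠ 0)
    (x x21 x31 x32 : k) :
    umat x * zmat t * Emat 1 0 x21 x31 x32 * (zmat t)⁻¹ * (umat x)⁻¹ =
      Emat t (x * t) (t ^ 2 * x21) (t ^ 3 * x31) (x * t ^ 3 * x31 + t ^ 3 * x32) := by
  have h := ((semiconjBy_umat x _ _ _ _ _).mul_left (semiconjBy_zmat ht 1 0 x21 x31 x32)).eq
  rw [h, Matrix.mul_assoc, Matrix.mul_assoc, Matrix.mul_assoc, ← Matrix.mul_assoc (zmat t),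
    Matrix.mul_nonsing_inv _ (isUnit_det_zmat ht), Matrix.one_mul,
    Matrix.mul_nonsing_inv _ (isUnit_det_umat x), Matrix.mul_one]
  congr 1 <;> ring

theorem Emat_mulVec {k : Type*} [Field k] (p q r s w : k) :
    Emat p q r s w *ᵥ ![0, 0, 1, 0, 0, 0, 0] =
      ![w + 2⁻¹ * (q * r), s + 2⁻¹ * (p * r), 1, -p, q,
        2⁻¹ * (2 * (p * w - q * s + r * r)), r] := by
  set A := Xmat 0 0 0 p q r s w 0 0 0 0 0 0 with hA
  have h1 : A *ᵥ ![0, 0, 1, 0, 0, 0, 0] = ![w, s, 0, -p, q, 0, r] := by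
    ext i
    fin_cases i <;> simp [hA, Xmat, Matrix.mulVec, dotProduct, Fin.sum_univ_succ]
  have h2 : A *ᵥ ![w, s, 0, -p, q, 0, r] =
      ![q * r, p * r, 0, 0, 0, 2 * (p * w - q * s + r * r), 0] := by
    ext i
    fin_cases i <;> simp [hA, Xmat, Matrix.mulVec, dotProduct, Fin.sum_univ_succ] <;> ring
  have h3 : A *ᵥ ![q * r, p * r, 0, 0, 0, 2 * (p * w - q * s + r * r), 0] = 0 := by
    ext i
    fin_cases i <;> simp [hA, Xmat, Matrix.mulVec, dotProduct, Fin.sum_univ_succ] <;> ring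
  rw [Emat, mexp, ← hA]
  simp only [Finset.sum_range_succ, Finset.sum_range_zero, Matrix.add_mulVec, Matrix.smul_mulVec,
    pow_succ, pow_zero, one_mul, ← Matrix.mulVec_mulVec, h1, h2, h3, Matrix.mulVec_zero,
    Matrix.one_mulVec, zero_add, smul_zero, add_zero]
  ext i
  fin_cases i <;> simp [Nat.factorial]

theorem Emat_inj {k : Type*} [Field k] {p q r s w p' q' r' s' w' : k}
    (h : Emat p q r s w = Emat p' q' r' s' w') :
    p = p' ∧ q = q' ∧ r = r' ∧ s = s' ∧ w = w' := by
  have h' := congrArg (· *ᵥ ![0, 0, 1, 0, 0, 0, 0]) h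
  simp only [Emat_mulVec] at h'
  have hp : p = p' := neg_injective (congrFun h' 3)
  have hq : q = q' := congrFun h' 4
  have hr : r = r' := congrFun h' 6
  subst hp hq hr
  exact ⟨rfl, rfl, rfl, add_right_cancel (congrFun h' 1), add_right_cancel (congrFun h' 0)⟩

/-- Lemma 1.5.3(i): the map `k × k^× × D₀ → N'`, `(x, t, n₀) ↦ u(x)·z(t)·n₀·z(t)⁻¹·u(x)⁻¹`,
is a bijection, where `N' = {E(x10,x11,x21,x31,x32) : x10 ≠ 0}` and
`D₀ = {E(1,0,x21,x31,x32)}`.  Explicitly, in exponential coordinates this map is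
`(x, t, x21, x31, x32) ↦ (t, x·t, t²·x21, t³·x31, x·t³·x31 + t³·x32)`, a bijection of
`k × k^× × k³` onto `{(x10,...,x32) : x10 ≠ 0}`. -/
theorem orbit_space_D0_bijection (k : Type*) [Field k] [CharZero k] :
    letI N' : Set (Matrix (Fin 7) (Fin 7) k) :=
      {n | ∃ x10 x11 x21 x31 x32 : k, x10 ≠ 0 ∧ n = Emat x10 x11 x21 x31 x32}
    letI D₀ : Set (Matrix (Fin 7) (Fin 7) k) :=
      {n | ∃ x21 x31 x32 : k, n = Emat 1 0 x21 x31 x32}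
    (∀ x t : k, t ≠ 0 → ∀ n ∈ D₀,
      umat x * zmat t * n * (zmat t)⁻¹ * (umat x)⁻¹ ∈ N') ∧
    (∀ n' ∈ N', ∃! q : k × k × Matrix (Fin 7) (Fin 7) k,
      q.2.1 ≠ 0 ∧ q.2.2 ∈ D₀ ∧
        umat q.1 * zmat q.2.1 * q.2.2 * (zmat q.2.1)⁻¹ * (umat q.1)⁻¹ = n') ∧
    (Set.BijOn
      (fun q : k × k × (k × k × k) =>
        (q.2.1, q.1 * q.2.1, q.2.1^2 * q.2.2.1, q.2.1^3 * q.2.2.2.1,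
          q.1 * q.2.1^3 * q.2.2.2.1 + q.2.1^3 * q.2.2.2.2))
      {q : k × k × (k × k × k) | q.2.1 ≠ 0}
      {v : k × k × k × k × k | v.1 ≠ 0}) := by
  refine ⟨?_, ?_, ?_, ?_, ?_⟩
  · rintro x t ht _ ⟨r, s, w, rfl⟩
    exact ⟨_, _, _, _, _, ht, umat_zmat_conj_Emat ht x r s w⟩
  · rintro _ ⟨p, q, r, s, w, hp, rfl⟩
    refine ⟨(q / p, p, Emat 1 0 (r / p ^ 2) (s / p ^ 3) ((w - q / p * s) / p ^ 3)),
      ⟨hp, ⟨_, _, _, rfl⟩, ?_⟩, ?_⟩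
    · dsimp only
      rw [umat_zmat_conj_Emat hp]
      congr 1 <;> field_simp
      ring
    · rintro ⟨x, t, _⟩ ⟨ht, ⟨r', s', w', rfl⟩, h⟩
      dsimp only at ht h
      rw [umat_zmat_conj_Emat ht] at h
      obtain ⟨rfl, rfl, rfl, rfl, rfl⟩ := Emat_inj h
      have hx : x * t / t = x := by field_simp
      have hr : t ^ 2 * r' / t ^ 2 = r' := by field_simp
      have hs : t ^ 3 * s' / t ^ 3 = s' := by field_simp
      have hw : (x * t ^ 3 * s' + t ^ 3 * w' - x * (t ^ 3 * s')) / t ^ 3 = w' := by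
        field_simp
        ring
      rw [hx, hr, hs, hw]
  · rintro ⟨x, t, r, s, w⟩ ht
    exact ht
  · rintro ⟨x, t, r, s, w⟩ ht ⟨x', t', r', s', w'⟩ - h
    simp only [Set.mem_ofPred_eq, Prod.mk.injEq] at ht h
    obtain ⟨rfl, hx, hr, hs, hw⟩ := h
    obtain rfl := mul_right_cancel₀ ht hx
    obtain rfl := mul_left_cancel₀ (pow_ne_zero 2 ht) hr
    obtain rfl := mul_left_cancel₀ (pow_ne_zero 3 ht) hs
    obtain rfl := mul_left_cancel₀ (pow_ne_zero 3 ht) (add_left_cancel hw)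
    rfl
  · rintro ⟨p, q, r, s, w⟩ hp
    simp only [Set.mem_ofPred_eq] at hp
    refine ⟨(q / p, p, r / p ^ 2, s / p ^ 3, (w - q / p * s) / p ^ 3), hp, ?_⟩
    simp only [Prod.mk.injEq, true_and]
    refine ⟨?_, ?_, ?_, ?_⟩ <;> field_simp
    ring
end

section
/- For every continuous compactly supported function f : k⁵ → ℂ, ∫_{k^×} ∫_k ∫_{k³} f(t, x·t, t²·x21, t³·x31, x·t³·x31 + t³·x32) · |t|¹⁰ d(x21, x31, x32) dx d^×t = ∫_{k⁵} f(x10, x11, x21, x31, x32) d(x10, x11, x21, x31, x32), where d^×t = |t|⁻¹ dt is a multiplicative Haar measure on k^×. (Lemma 1.5.3(ii): with the measure dx21 dx31 dx32 on the fundamental domain D₀ and the modulus factor q^{⟨2ρ, H_M(z)⟩} = |t|¹⁰, integration over N is recovered by triple integration over Z_M, U_M and D₀.) -/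
open MeasureTheory

open scoped NNReal Pointwise in
/-- Multiplication by `p` scales the Haar measure on `ℚ_[p]` by `p⁻¹`. -/
theorem Padic.distribHaarChar_prime (p : ℕ) [hp : Fact p.Prime]
    (π : ℚ_[p]ˣ) (hπ : (π : ℚ_[p]) = p) : distribHaarChar ℚ_[p] π = (p : ℝ≥0)⁻¹ := by
  borelize ℚ_[p]
  set μ : Measure ℚ_[p] := Measure.addHaar
  set B : Set ℚ_[p] := Metric.closedBall 0 1
  have hp0 : (p : ℚ_[p]) ≠ 0 := by exact_mod_cast hp.out.ne_zero
  have hB : IsOpen B := IsUltrametricDist.isOpen_closedBall 0 one_ne_zero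
  have hB0 : μ B ≠ 0 := (hB.measure_pos μ ⟨0, by simp [B]⟩).ne'
  have hBt : μ B ≠ ⊤ := (isCompact_closedBall (0 : ℚ_[p]) 1).measure_lt_top.ne
  have mem_smul (x : ℚ_[p]) : x ∈ π • B ↔ ‖x‖ < 1 := by
    rw [Set.mem_smul_set_iff_inv_smul_mem]
    simp only [B, mem_closedBall_zero_iff, Units.smul_def, Units.val_inv_eq_inv_val, hπ,
      smul_eq_mul, norm_mul, norm_inv, Padic.norm_p, inv_inv]
    have := Padic.norm_le_pow_iff_norm_lt_pow_add_one x (-1)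
    simp only [zpow_neg, zpow_one, neg_add_cancel, zpow_zero] at this
    rw [← this, ← one_div, le_div_iff₀' (by exact_mod_cast hp.out.pos)]
  have hunion : B = ⋃ n ∈ Finset.range p, (n : ℚ_[p]) +ᵥ (π • B) := by
    ext x
    simp only [Set.mem_iUnion, Set.mem_vadd_set_iff_neg_vadd_mem, mem_smul, vadd_eq_add,
      Finset.mem_range, exists_prop, neg_add_eq_sub]
    constructor
    · intro hx
      let y : ℤ_[p] := ⟨x, by simpa [B] using hx⟩
      exact ⟨y.zmodRepr, y.zmodRepr_lt_p, by
        simpa [PadicInt.norm_def, -PadicInt.padic_norm_e_of_padicInt] using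
          y.norm_sub_zmodRepr_lt_one⟩
    · rintro ⟨n, -, hn⟩
      have := Padic.nonarchimedean (x - (n : ℚ_[p])) n
      rw [sub_add_cancel] at this
      exact mem_closedBall_zero_iff.2
        (this.trans (max_le hn.le (IsUltrametricDist.norm_natCast_le_one ℚ_[p] n)))
  have hdisj : (Finset.range p : Set ℕ).PairwiseDisjoint
      (fun n : ℕ ↦ (n : ℚ_[p]) +ᵥ (π • B)) := by
    intro m hm n hn hmn
    refine Set.disjoint_left.2 fun x hxm hxn ↦ hmn ?_
    simp only [Set.mem_vadd_set_iff_neg_vadd_mem, mem_smul, vadd_eq_add, neg_add_eq_sub]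
      at hxm hxn
    have h : ‖((m - n : ℤ) : ℚ_[p])‖ < 1 := by
      have := Padic.nonarchimedean (x - (n : ℚ_[p])) (-(x - (m : ℚ_[p])))
      rw [norm_neg] at this
      have h2 : ((m - n : ℤ) : ℚ_[p]) = (x - n) + -(x - m) := by push_cast; ring
      rw [h2]
      exact this.trans_lt (max_lt hxn hxm)
    rw [Padic.norm_intCast_lt_one_iff] at h
    simp only [Finset.coe_range, Set.mem_Iio] at hm hn
    have := Int.eq_zero_of_abs_lt_dvd h (by rw [abs_lt]; omega)
    omega
  have hpB : IsOpen (π • B) := hB.smul π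
  have key : μ B = p * μ (π • B) := by
    conv_lhs => rw [hunion]
    rw [measure_biUnion_finset hdisj fun n _ ↦ (hpB.vadd _).measurableSet]
    simp [measure_vadd]
  refine distribHaarChar_eq_of_measure_smul_eq_mul (μ := μ) hB0 hBt ?_
  have hpN : (p : ℝ≥0) ≠ 0 := by exact_mod_cast hp.out.ne_zero
  rw [key, ← mul_assoc, ENNReal.coe_inv hpN, ENNReal.coe_natCast,
    ENNReal.inv_mul_cancel (by exact_mod_cast hp.out.ne_zero) (ENNReal.natCast_ne_top p), one_mul]

open scoped NNReal Pointwise in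
theorem Padic.distribHaarChar_of_norm_eq_one (p : ℕ) [Fact p.Prime]
    (u : ℚ_[p]ˣ) (hu : ‖(u : ℚ_[p])‖ = 1) : distribHaarChar ℚ_[p] u = 1 := by
  borelize ℚ_[p]
  have hB : IsOpen (Metric.closedBall (0 : ℚ_[p]) 1) :=
    IsUltrametricDist.isOpen_closedBall 0 one_ne_zero
  refine distribHaarChar_eq_of_measure_smul_eq_mul (μ := Measure.addHaar)
    (s := Metric.closedBall 0 1) (hB.measure_pos _ ⟨0, by simp⟩).ne'
    (isCompact_closedBall (0 : ℚ_[p]) 1).measure_lt_top.ne ?_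
  rw [ENNReal.coe_one, one_mul]
  congr 1
  ext x
  rw [Set.mem_smul_set_iff_inv_smul_mem]
  simp [Units.smul_def, hu]

/-- The distributive Haar character of `ℚ_[p]` is the `p`-adic norm. -/
theorem Padic.distribHaarChar_eq_nnnorm (p : ℕ) [hp : Fact p.Prime] (a : ℚ_[p]ˣ) :
    distribHaarChar ℚ_[p] a = ‖(a : ℚ_[p])‖₊ := by
  have hp0 : (p : ℚ_[p]) ≠ 0 := by exact_mod_cast hp.out.ne_zero
  set π : ℚ_[p]ˣ := Units.mk0 p hp0
  set v := (a : ℚ_[p]).valuation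
  set u : ℚ_[p]ˣ := a * π ^ (-v)
  have ha : a = u * π ^ v := by simp [u]
  have hu : ‖(u : ℚ_[p])‖ = 1 := by
    have hpR : (p : ℝ) ≠ 0 := by exact_mod_cast hp.out.ne_zero
    simp [u, π, v, Padic.norm_eq_zpow_neg_valuation a.ne_zero,
      inv_mul_cancel₀ (zpow_ne_zero _ hpR)]
  apply NNReal.coe_injective
  rw [coe_nnnorm, ha, map_mul, map_zpow, Padic.distribHaarChar_of_norm_eq_one p u hu,
    Padic.distribHaarChar_prime p π rfl]
  simp [hu, π]

open scoped Pointwise in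
/-- Change of variables `x ↦ a * x` for integrals over `ℚ_[p]`. -/
theorem Padic.integral_comp_mul_left {E : Type*} [NormedAddCommGroup E] [NormedSpace ℝ E]
    (p : ℕ) [Fact p.Prime] [MeasurableSpace ℚ_[p]] [BorelSpace ℚ_[p]]
    (μ : Measure ℚ_[p]) [μ.IsAddHaarMeasure] {a : ℚ_[p]} (ha : a ≠ 0) (g : ℚ_[p] → E) :
    ∫ x, g (a * x) ∂μ = ‖a‖⁻¹ • ∫ x, g x ∂μ := by
  have hemb : MeasurableEmbedding (fun x : ℚ_[p] ↦ a * x) :=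
    (Homeomorph.mulLeft₀ a ha).measurableEmbedding
  have hmap : μ.map (fun x ↦ a * x) = ‖a‖₊⁻¹ • μ := by
    ext s hs
    have hpre : (fun x ↦ a * x) ⁻¹' s = (Units.mk0 a ha)⁻¹ • s := by
      rw [← Set.preimage_smul]; rfl
    rw [hemb.map_apply, hpre, ← distribHaarChar_mul μ, map_inv, Padic.distribHaarChar_eq_nnnorm]
    rfl
  rw [← hemb.integral_map, hmap, integral_smul_nnreal_measure]
  simp [NNReal.smul_def]

/-- Lemma 1.5.3(ii): with the measure `dx21 dx31 dx32` on the fundamental domain `D₀` and the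
modulus factor `q^{⟨2ρ, H_M(z)⟩} = |t|¹⁰`, integration over `N` is recovered by triple
integration over `Z_M`, `U_M` and `D₀`: for every continuous compactly supported
`f : k⁵ → ℂ`,
`∫_{k^×} ∫_k ∫_{k³} f(t, x·t, t²·x21, t³·x31, x·t³·x31 + t³·x32) |t|¹⁰ d(x21,x31,x32) dx d^×t
  = ∫_{k⁵} f`, where `d^×t = |t|⁻¹ dt`. -/
theorem orbit_space_measure_D0 (p : ℕ) [Fact p.Prime]
    [MeasurableSpace ℚ_[p]] [BorelSpace ℚ_[p]]
    (μ : Measure ℚ_[p]) [μ.IsAddHaarMeasure]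
    (f : ℚ_[p] × ℚ_[p] × ℚ_[p] × ℚ_[p] × ℚ_[p] → ℂ)
    (hf : Continuous f) (hsupp : HasCompactSupport f) :
    (∫ t in {t : ℚ_[p] | t ≠ 0},
        (∫ x, ∫ x21, ∫ x31, ∫ x32,
          f (t, x*t, t^2*x21, t^3*x31, x*t^3*x31 + t^3*x32)
            * ((‖t‖^10 : ℝ) : ℂ) ∂μ ∂μ ∂μ ∂μ) * ((‖t‖ : ℝ) : ℂ)⁻¹ ∂μ)
      = ∫ x10, ∫ x11, ∫ x21, ∫ x31, ∫ x32,
          f (x10, x11, x21, x31, x32) ∂μ ∂μ ∂μ ∂μ ∂μ := by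
  have hne : ∀ᵐ t ∂μ, t ∈ {t : ℚ_[p] | t ≠ 0} := by
    simp [ae_iff]
  rw [Measure.restrict_eq_self_of_ae_mem hne]
  refine integral_congr_ae (hne.mono fun t (ht : t ≠ 0) ↦ ?_)
  have ht' : ((‖t‖ : ℝ) : ℂ) ≠ 0 := by simpa using ht
  have h32 (x x21 x31 : ℚ_[p]) :
      ∫ x32, f (t, x*t, t^2*x21, t^3*x31, x*t^3*x31 + t^3*x32) ∂μ
        = ‖t^3‖⁻¹ • ∫ y, f (t, x*t, t^2*x21, t^3*x31, y) ∂μ := by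
    rw [← integral_add_left_eq_self
      (fun y ↦ f (t, x*t, t^2*x21, t^3*x31, y)) (x*t^3*x31)]
    exact Padic.integral_comp_mul_left p μ (pow_ne_zero 3 ht)
      fun y ↦ f (t, x*t, t^2*x21, t^3*x31, x*t^3*x31 + y)
  have h31 (x x21 : ℚ_[p]) :=
    Padic.integral_comp_mul_left p μ (pow_ne_zero 3 ht)
      fun x31 ↦ ∫ y, f (t, x*t, t^2*x21, x31, y) ∂μ
  have h21 (x : ℚ_[p]) :=
    Padic.integral_comp_mul_left p μ (pow_ne_zero 2 ht)
      fun x21 ↦ ∫ x31, ∫ y, f (t, x*t, x21, x31, y) ∂μ ∂μ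
  have h11 :=
    Padic.integral_comp_mul_left p μ ht
      fun x ↦ ∫ x21, ∫ x31, ∫ y, f (t, x, x21, x31, y) ∂μ ∂μ ∂μ
  simp only [mul_comm t] at h11
  simp only [integral_mul_const, h32, integral_smul, h31, h21, h11]
  simp only [Complex.real_smul, norm_pow]
  push_cast
  field_simp
end

section
/- (Lemma 1.7.1(i).) For an integer κ ≥ 1 let N̄_κ = {Ē(y10,y11,y21,y31,y32) : v(y10) ≥ −κ², v(y11) ≥ −κ, v(y21) ≥ −κ³, v(y31) ≥ −κ⁵, v(y32) ≥ −κ⁴} ⊂ GL₇(ℚ_p). Then there exists κ₀ such that for all κ ≥ κ₀: (a) N̄_κ is a subgroup of GL₇(ℚ_p) (contains the identity and is closed under multiplication and inversion); and (b) for all t, t' ∈ ℚ_p^× with |t| = |t'|, one has z(t)·N̄_κ·z(t)⁻¹ = z(t')·N̄_κ·z(t')⁻¹, i.e. the conjugate subgroup z(t)·N̄_κ·z(t)⁻¹ depends only on |t|. -/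
open Matrix

/-- The compact open subset `N̄_κ ⊂ N̄`: the set of `Ē(y10,y11,y21,y31,y32)` with
`v(y10) ≥ -κ²`, `v(y11) ≥ -κ`, `v(y21) ≥ -κ³`, `v(y31) ≥ -κ⁵`, `v(y32) ≥ -κ⁴`,
equivalently `‖y10‖ ≤ p^(κ²)`, `‖y11‖ ≤ p^κ`, `‖y21‖ ≤ p^(κ³)`, `‖y31‖ ≤ p^(κ⁵)`,
`‖y32‖ ≤ p^(κ⁴)`. -/
def NbarK (p : ℕ) [Fact p.Prime] (κ : ℕ) : Set (Matrix (Fin 7) (Fin 7) ℚ_[p]) :=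
  {M | ∃ y10 y11 y21 y31 y32 : ℚ_[p],
    ‖y10‖ ≤ (p : ℝ)^(κ^2) ∧ ‖y11‖ ≤ (p : ℝ)^κ ∧ ‖y21‖ ≤ (p : ℝ)^(κ^3) ∧
    ‖y31‖ ≤ (p : ℝ)^(κ^5) ∧ ‖y32‖ ≤ (p : ℝ)^(κ^4) ∧
    M = Ebar y10 y11 y21 y31 y32}

theorem mexp_of_pow_three_eq_zero {k : Type*} [Field k] {A : Matrix (Fin 7) (Fin 7) k}
    (hA : A ^ 3 = 0) : mexp A = 1 + A + (2 : k)⁻¹ • (A * A) := by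
  have h (n : ℕ) : A ^ (n + 3) = 0 := by rw [pow_add, hA, mul_zero]
  simp [mexp, Finset.sum_range_succ, h 0, h 1, h 2, h 3, pow_two]

set_option maxHeartbeats 2000000 in
/-- The entries of `Ē(y10, y11, y21, y31, y32)`. -/
theorem Ebar_eq {k : Type*} [Field k] [CharZero k] (a10 a11 a21 a31 a32 : k) :
    Ebar a10 a11 a21 a31 a32 =
      !![1, 0, 0, 0, 0, a10, 0;
         0, 1, 0, 0, 0, -a11, 0;
         a11*a21/2 + a32, a10*a21/2 + a31, 1, -a10, a11, a10*a32 - a11*a31 + a21*a21, 2*a21;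
         a11*a11, a10*a11 + a21, 0, 1, 0, a11*a21/2 - a32, 2*a11;
         a10*a11 - a21, a10*a10, 0, 0, 1, a10*a21/2 - a31, 2*a10;
         0, 0, 0, 0, 0, 1, 0;
         a11, a10, 0, 0, 0, a21, 1] := by
  have hsq : Xmat 0 0 0 0 0 0 0 0 0 a10 a11 a21 a31 a32 *
      Xmat 0 0 0 0 0 0 0 0 0 a10 a11 a21 a31 a32 =
      !![0, 0, 0, 0, 0, 0, 0;
         0, 0, 0, 0, 0, 0, 0;
         a11*a21, a10*a21, 0, 0, 0, 2*(a10*a32 - a11*a31 + a21*a21), 0;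
         2*(a11*a11), 2*(a10*a11), 0, 0, 0, a11*a21, 0;
         2*(a10*a11), 2*(a10*a10), 0, 0, 0, a10*a21, 0;
         0, 0, 0, 0, 0, 0, 0;
         0, 0, 0, 0, 0, 0, 0] := by
    ext i j
    fin_cases i <;> fin_cases j <;> simp [Xmat, Matrix.mul_apply, Fin.sum_univ_succ] <;> ring
  have hcube : Xmat 0 0 0 0 0 0 0 0 0 a10 a11 a21 a31 a32 ^ 3 = 0 := by
    rw [pow_succ, pow_two, hsq]
    ext i j
    fin_cases i <;> fin_cases j <;> simp [Xmat, Matrix.mul_apply, Fin.sum_univ_succ] <;> ring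
  rw [Ebar, mexp_of_pow_three_eq_zero hcube, hsq]
  ext i j
  fin_cases i <;> fin_cases j <;> simp [Xmat] <;> field

/-- The group law of `N̄` in exponential coordinates. -/
theorem Ebar_mul {k : Type*} [Field k] [CharZero k]
    (a10 a11 a21 a31 a32 b10 b11 b21 b31 b32 : k) :
    Ebar a10 a11 a21 a31 a32 * Ebar b10 b11 b21 b31 b32 =
      Ebar (a10 + b10) (a11 + b11) (a21 + b21 + (a11 * b10 - a10 * b11))
        (a31 + b31 + 2⁻¹ * ((a10 - b10) * (a10 * b11 - a11 * b10) + 3 * (a21 * b10 - a10 * b21)))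
        (a32 + b32 +
          2⁻¹ * ((a11 - b11) * (a10 * b11 - a11 * b10) + 3 * (a21 * b11 - a11 * b21))) := by
  simp only [Ebar_eq]
  ext i j
  fin_cases i <;> fin_cases j <;> simp [Matrix.mul_apply, Fin.sum_univ_succ] <;> field

theorem Ebar_zero {k : Type*} [Field k] [CharZero k] : Ebar (0 : k) 0 0 0 0 = 1 := by
  rw [Ebar_eq]
  ext i j
  fin_cases i <;> fin_cases j <;> simp

theorem Ebar_inv {k : Type*} [Field k] [CharZero k] (a10 a11 a21 a31 a32 : k) :
    (Ebar a10 a11 a21 a31 a32)⁻¹ = Ebar (-a10) (-a11) (-a21) (-a31) (-a32) := by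
  apply Matrix.inv_eq_right_inv
  rw [Ebar_mul, ← Ebar_zero]
  congr 1 <;> ring

theorem zmat_mul {k : Type*} [Field k] (s t : k) : zmat (s * t) = zmat s * zmat t := by
  simp only [zmat, Matrix.diagonal_mul_diagonal]
  congr 1
  ext i
  fin_cases i <;> simp [mul_pow, mul_comm]

theorem zmat_mul_zmat_inv {k : Type*} [Field k] {t : k} (ht : t ≠ 0) :
    zmat t * zmat t⁻¹ = 1 := by
  rw [← zmat_mul, mul_inv_cancel₀ ht, zmat, ← Matrix.diagonal_one]
  congr 1
  ext i
  fin_cases i <;> simp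

theorem zmat_inv {k : Type*} [Field k] {t : k} (ht : t ≠ 0) : (zmat t)⁻¹ = zmat t⁻¹ :=
  Matrix.inv_eq_right_inv (zmat_mul_zmat_inv ht)

set_option maxHeartbeats 2000000 in
/-- Conjugation by `z(t)` scales the exponential coordinates of `N̄`. -/
theorem zmat_mul_Ebar_mul_inv {k : Type*} [Field k] [CharZero k] {t : k} (ht : t ≠ 0)
    (a10 a11 a21 a31 a32 : k) :
    zmat t * Ebar a10 a11 a21 a31 a32 * (zmat t)⁻¹ =
      Ebar (t⁻¹ * a10) (t⁻¹ * a11) (t⁻¹ ^ 2 * a21) (t⁻¹ ^ 3 * a31) (t⁻¹ ^ 3 * a32) := by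
  rw [zmat_inv ht, Ebar_eq, Ebar_eq]
  ext i j
  fin_cases i <;> fin_cases j <;>
    simp [zmat, Matrix.diagonal_mul, Matrix.mul_diagonal] <;> field

theorem conj_zmat_image_NbarK_subset (p : ℕ) [Fact p.Prime] (κ : ℕ) {t t' : ℚ_[p]}
    (ht : t ≠ 0) (ht' : t' ≠ 0) (h : ‖t‖ = ‖t'‖) :
    (fun M => zmat t * M * (zmat t)⁻¹) '' NbarK p κ ⊆
      (fun M => zmat t' * M * (zmat t')⁻¹) '' NbarK p κ := by
  rintro _ ⟨_, ⟨y10, y11, y21, y31, y32, h10, h11, h21, h31, h32, rfl⟩, rfl⟩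
  have hu : ‖t' * t⁻¹‖ = 1 := by
    rw [norm_mul, norm_inv, h, mul_inv_cancel₀ (norm_ne_zero_iff.mpr ht')]
  refine ⟨_, ⟨t' * t⁻¹ * y10, t' * t⁻¹ * y11, (t' * t⁻¹) ^ 2 * y21, (t' * t⁻¹) ^ 3 * y31,
    (t' * t⁻¹) ^ 3 * y32, ?_, ?_, ?_, ?_, ?_, rfl⟩, ?_⟩
  · rwa [norm_mul, hu, one_mul]
  · rwa [norm_mul, hu, one_mul]
  · rwa [norm_mul, norm_pow, hu, one_pow, one_mul]
  · rwa [norm_mul, norm_pow, hu, one_pow, one_mul]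
  · rwa [norm_mul, norm_pow, hu, one_pow, one_mul]
  · simp only [zmat_mul_Ebar_mul_inv ht, zmat_mul_Ebar_mul_inv ht']
    congr 1 <;> field

theorem Padic.norm_add_le_of_le {p : ℕ} [Fact p.Prime] {x y : ℚ_[p]} {r : ℝ}
    (hx : ‖x‖ ≤ r) (hy : ‖y‖ ≤ r) : ‖x + y‖ ≤ r :=
  (Padic.nonarchimedean x y).trans (max_le hx hy)

theorem Padic.norm_sub_le_of_le {p : ℕ} [Fact p.Prime] {x y : ℚ_[p]} {r : ℝ}
    (hx : ‖x‖ ≤ r) (hy : ‖y‖ ≤ r) : ‖x - y‖ ≤ r := by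
  rw [sub_eq_add_neg]
  exact Padic.norm_add_le_of_le hx (by rwa [norm_neg])

theorem norm_mul_le_pow_add {K : Type*} [NormedField K] {x y : K} {r : ℝ} {m n : ℕ}
    (hx : ‖x‖ ≤ r ^ m) (hy : ‖y‖ ≤ r ^ n) : ‖x * y‖ ≤ r ^ (m + n) := by
  rw [norm_mul, pow_add]
  exact mul_le_mul hx hy (norm_nonneg y) ((norm_nonneg x).trans hx)

/-- The quantitative estimate for the cubic terms of the group law of `N̄`. -/
theorem Padic.norm_two_inv_mul_bch_le {p : ℕ} [Fact p.Prime] {c l m n e : ℕ}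
    {a b x y u v d : ℚ_[p]} (h2 : ‖(2 : ℚ_[p])⁻¹‖ ≤ (p : ℝ) ^ c)
    (ha : ‖a‖ ≤ (p : ℝ) ^ l) (hb : ‖b‖ ≤ (p : ℝ) ^ l) (hd : ‖d‖ ≤ (p : ℝ) ^ m)
    (hu : ‖u‖ ≤ (p : ℝ) ^ n) (hv : ‖v‖ ≤ (p : ℝ) ^ n)
    (hx : ‖x‖ ≤ (p : ℝ) ^ e) (hy : ‖y‖ ≤ (p : ℝ) ^ e)
    (hm : c + (l + m) ≤ e) (hn : c + (l + n) ≤ e) :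
    ‖x + y + 2⁻¹ * ((a - b) * d + 3 * (u * b - a * v))‖ ≤ (p : ℝ) ^ e := by
  have hp : (1 : ℝ) ≤ p := by exact_mod_cast (Fact.out : p.Prime).one_le
  have h3 : ‖(3 : ℚ_[p])‖ ≤ (p : ℝ) ^ 0 := by
    simpa using Padic.norm_int_le_one (p := p) 3
  have mono {z : ℚ_[p]} {i j : ℕ} (hz : ‖z‖ ≤ (p : ℝ) ^ i) (hij : i ≤ j) : ‖z‖ ≤ (p : ℝ) ^ j :=
    hz.trans (pow_le_pow_right₀ hp hij)
  refine norm_add_le_of_le (norm_add_le_of_le hx hy) ?_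
  rw [mul_add]
  refine norm_add_le_of_le ?_ ?_
  · exact mono (norm_mul_le_pow_add h2 (norm_mul_le_pow_add (norm_sub_le_of_le ha hb) hd)) hm
  · refine mono (norm_mul_le_pow_add h2 (norm_mul_le_pow_add h3 (n := l + n)
      (norm_sub_le_of_le ?_ (norm_mul_le_pow_add ha hv)))) (by omega)
    rw [mul_comm]
    exact norm_mul_le_pow_add hb hu

theorem mul_mem_NbarK {p : ℕ} [Fact p.Prime] {c κ : ℕ} (h2 : ‖(2 : ℚ_[p])⁻¹‖ ≤ (p : ℝ) ^ c)
    (hκ : c + 3 ≤ κ) {A B : Matrix (Fin 7) (Fin 7) ℚ_[p]} (hA : A ∈ NbarK p κ)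
    (hB : B ∈ NbarK p κ) : A * B ∈ NbarK p κ := by
  obtain ⟨a10, a11, a21, a31, a32, ha10, ha11, ha21, ha31, ha32, rfl⟩ := hA
  obtain ⟨b10, b11, b21, b31, b32, hb10, hb11, hb21, hb31, hb32, rfl⟩ := hB
  have hp : (1 : ℝ) ≤ p := by exact_mod_cast (Fact.out : p.Prime).one_le
  have e2 : 3 * κ ≤ κ ^ 2 := by rw [pow_two]; exact Nat.mul_le_mul_right κ (by omega)
  have e3 : 3 * κ ^ 2 ≤ κ ^ 3 := by
    rw [pow_succ κ 2, mul_comm]; exact Nat.mul_le_mul_left _ (by omega)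
  have e4 : 3 * κ ^ 3 ≤ κ ^ 4 := by
    rw [pow_succ κ 3, mul_comm]; exact Nat.mul_le_mul_left _ (by omega)
  have e5 : κ ^ 4 ≤ κ ^ 5 := Nat.pow_le_pow_right (by omega) (by norm_num)
  have hd : ‖a10 * b11 - a11 * b10‖ ≤ (p : ℝ) ^ (κ ^ 2 + κ) := by
    refine Padic.norm_sub_le_of_le (norm_mul_le_pow_add ha10 hb11) ?_
    rw [mul_comm]
    exact norm_mul_le_pow_add hb10 ha11
  refine ⟨_, _, _, _, _, Padic.norm_add_le_of_le ha10 hb10, Padic.norm_add_le_of_le ha11 hb11,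
    Padic.norm_add_le_of_le (Padic.norm_add_le_of_le ha21 hb21) ?_,
    Padic.norm_two_inv_mul_bch_le h2 ha10 hb10 hd ha21 hb21 ha31 hb31 (by omega) (by omega),
    Padic.norm_two_inv_mul_bch_le h2 ha11 hb11 hd ha21 hb21 ha32 hb32 (by omega) (by omega),
    Ebar_mul ..⟩
  rw [norm_sub_rev]
  exact hd.trans (pow_le_pow_right₀ hp (by omega))

/-- Lemma 1.7.1(i): for all sufficiently large `κ`, the set `N̄_κ` is a subgroup of
`GL₇(ℚ_p)` (it contains the identity and is closed under multiplication and inversion),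
and the conjugate subgroup `z(t)·N̄_κ·z(t)⁻¹` depends only on `|t|`. -/
theorem nbar_kappa_subgroups (p : ℕ) [Fact p.Prime] :
    ∃ κ₀ : ℕ, ∀ κ : ℕ, κ₀ ≤ κ →
      ((1 : Matrix (Fin 7) (Fin 7) ℚ_[p]) ∈ NbarK p κ ∧
        (∀ A ∈ NbarK p κ, ∀ B ∈ NbarK p κ, A * B ∈ NbarK p κ) ∧
        (∀ A ∈ NbarK p κ, A⁻¹ ∈ NbarK p κ)) ∧
      (∀ t t' : ℚ_[p], t ≠ 0 → t' ≠ 0 → ‖t‖ = ‖t'‖ →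
        (fun M => zmat t * M * (zmat t)⁻¹) '' NbarK p κ =
          (fun M => zmat t' * M * (zmat t')⁻¹) '' NbarK p κ) := by
  have hp : (1 : ℝ) < p := by exact_mod_cast (Fact.out : p.Prime).one_lt
  obtain ⟨c, hc⟩ := pow_unbounded_of_one_lt ‖(2 : ℚ_[p])⁻¹‖ hp
  refine ⟨c + 3, fun κ hκ => ⟨⟨?_, fun A hA B hB => mul_mem_NbarK hc.le hκ hA hB, ?_⟩, ?_⟩⟩
  · refine ⟨0, 0, 0, 0, 0, ?_, ?_, ?_, ?_, ?_, Ebar_zero.symm⟩ <;> rw [norm_zero] <;> positivity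
  · rintro _ ⟨y10, y11, y21, y31, y32, h10, h11, h21, h31, h32, rfl⟩
    refine ⟨-y10, -y11, -y21, -y31, -y32, ?_, ?_, ?_, ?_, ?_, Ebar_inv ..⟩ <;> rwa [norm_neg]
  · intro t t' ht ht' h
    exact (conj_zmat_image_NbarK_subset p κ ht ht' h).antisymm
      (conj_zmat_image_NbarK_subset p κ ht' ht h.symm)
end
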